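/- arXiv:1306.0811 — 4 statements merged into one kernel-verified Lean document; each statement's English description precedes it below -/
import Mathlib

section
/- Let d, n, T ≥ 1, let B > 0, and let z_1,...,z_T ∈ ℝ^{dn} satisfy ‖z_t‖ ≤ B for all t. Define M_0 = I_{dn} and M_t = M_{t−1} + z_t z_t^T for t = 1,...,T. Then Σ_{t=1}^T z_t^T M_{t−1}^{−1} z_t ≤ (1 + B²) · ln det M_T. -/
open Matrix

/-- If `M - 1` is positive semidefinite, then `xᵀ M⁻¹ x ≤ xᵀ x`. -/
theorem Matrix.PosSemidef.dotProduct_inv_mulVec_le {ι : Type*} [Fintype ι] [DecidableEq ι]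
    {M : Matrix ι ι ℝ} (hP : (M - 1).PosSemidef) (hdet : IsUnit M.det) (x : ι → ℝ) :
    x ⬝ᵥ (M⁻¹ *ᵥ x) ≤ x ⬝ᵥ x := by
  set w := M⁻¹ *ᵥ x with hw
  set p := (M - 1) *ᵥ w with hp
  have hx : x = w + p := by
    rw [hp, sub_mulVec, one_mulVec, add_sub_cancel, hw, mulVec_mulVec, mul_nonsing_inv _ hdet,
      one_mulVec]
  have hwp : 0 ≤ w ⬝ᵥ p := by simpa using hP.dotProduct_mulVec_nonneg w
  have hpp : 0 ≤ p ⬝ᵥ p := by simpa using dotProduct_star_self_nonneg p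
  clear_value w p
  subst hx
  simp only [add_dotProduct, dotProduct_add, dotProduct_comm p w]
  linarith

/-- The **matrix determinant lemma** for a rank-one update `M + u vᵀ`. -/
theorem Matrix.det_add_vecMulVec {ι R : Type*} [Fintype ι] [DecidableEq ι] [CommRing R]
    {M : Matrix ι ι R} (hdet : IsUnit M.det) (u v : ι → R) :
    (M + vecMulVec u v).det = M.det * (1 + v ⬝ᵥ (M⁻¹ *ᵥ u)) := by
  rw [vecMulVec_eq Unit, det_add_replicateCol_mul_replicateRow hdet, dotProduct_mulVec]
  rw [det_unique (n := Unit), ← replicateRow_vecMul, add_apply, one_apply_eq,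
    replicateRow_mul_replicateCol_apply]

theorem Real.le_one_add_mul_log_one_add {a b : ℝ} (ha : 0 ≤ a) (hab : a ≤ b) :
    a ≤ (1 + b) * Real.log (1 + a) := by
  have hpos : 0 < 1 + a := by linarith
  calc a = (1 + a) * (1 - (1 + a)⁻¹) := by field_simp; ring
    _ ≤ (1 + a) * Real.log (1 + a) := by
        gcongr
        exact Real.one_sub_inv_le_log_of_pos hpos
    _ ≤ (1 + b) * Real.log (1 + a) := by
        gcongr
        exact Real.log_nonneg (by linarith)

/-- One step of the elliptical potential argument: the quadratic form is controlled by the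
increase of the log-determinant. -/
theorem Matrix.PosSemidef.dotProduct_inv_mulVec_le_log_det_sub {ι : Type*} [Fintype ι]
    [DecidableEq ι] {M : Matrix ι ι ℝ} (hP : (M - 1).PosSemidef) {x : ι → ℝ} {b : ℝ}
    (hx : x ⬝ᵥ x ≤ b) :
    x ⬝ᵥ (M⁻¹ *ᵥ x) ≤
      (1 + b) * (Real.log (M + vecMulVec x x).det - Real.log M.det) := by
  have hM : M.PosDef := by simpa using PosDef.one.add_posSemidef hP
  have hdet : IsUnit M.det := hM.det_pos.ne'.isUnit
  have ha : 0 ≤ x ⬝ᵥ (M⁻¹ *ᵥ x) := by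
    simpa using hM.inv.posSemidef.dotProduct_mulVec_nonneg x
  rw [det_add_vecMulVec hdet, Real.log_mul hM.det_pos.ne' (by positivity), add_sub_cancel_left]
  exact Real.le_one_add_mul_log_one_add ha ((hP.dotProduct_inv_mulVec_le hdet x).trans hx)

/-- Elliptical potential bound: for `M_0 = I`, `M_t = M_{t-1} + z_t z_tᵀ` with
`‖z_t‖ ≤ B`, the sum of the quadratic forms `z_tᵀ M_{t-1}⁻¹ z_t` is at most
`(1 + B²) ln det M_T`. -/
theorem elliptical_potential (d n T : ℕ) (hd : 1 ≤ d) (hn : 1 ≤ n) (hT : 1 ≤ T)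
    (B : ℝ) (hB : 0 < B)
    (z : Fin T → EuclideanSpace ℝ (Fin (d * n)))
    (hz : ∀ t : Fin T, ‖z t‖ ≤ B)
    (M : ℕ → Matrix (Fin (d * n)) (Fin (d * n)) ℝ)
    (hM0 : M 0 = 1)
    (hM : ∀ t : Fin T, M ((t : ℕ) + 1) = M (t : ℕ) + vecMulVec (z t) (z t)) :
    ∑ t : Fin T, z t ⬝ᵥ ((M (t : ℕ))⁻¹ *ᵥ z t) ≤ (1 + B ^ 2) * Real.log (M T).det := by
  have hP : ∀ k ≤ T, (M k - 1).PosSemidef := by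
    intro k
    induction k with
    | zero => intro _; simpa [hM0] using PosSemidef.zero
    | succ k ih =>
      intro hk
      rw [hM ⟨k, hk⟩, add_sub_right_comm]
      refine (ih (by omega)).add ?_
      simpa using posSemidef_vecMulVec_self_star (z ⟨k, hk⟩).ofLp
  have hnorm : ∀ t, z t ⬝ᵥ z t ≤ B ^ 2 := by
    intro t
    have h : (z t).ofLp ⬝ᵥ (z t).ofLp = ‖z t‖ ^ 2 := by
      rw [EuclideanSpace.real_norm_sq_eq]
      simp only [dotProduct, sq]
    rw [h]
    gcongr
    exact hz t
  calc ∑ t : Fin T, z t ⬝ᵥ ((M (t : ℕ))⁻¹ *ᵥ z t)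
      ≤ ∑ t : Fin T, (1 + B ^ 2) *
          (Real.log (M ((t : ℕ) + 1)).det - Real.log (M (t : ℕ)).det) := by
        refine Finset.sum_le_sum fun t _ => ?_
        rw [hM t]
        exact (hP t t.isLt.le).dotProduct_inv_mulVec_le_log_det_sub (hnorm t)
    _ = (1 + B ^ 2) * Real.log (M T).det := by
        rw [← Finset.mul_sum, Fin.sum_univ_eq_sum_range
          (fun i => Real.log (M (i + 1)).det - Real.log (M i).det) T,
          Finset.sum_range_sub (fun i => Real.log (M i).det)]
        simp [hM0]
end

section
/- Let d ≥ 1, n ≥ 1, T ≥ 1, let L be the Laplacian of the complete graph K_n, and set A_⊗ = (I_n + L) ⊗ I_d. Let i_1,...,i_T ∈ {1,...,n} and let x_1,...,x_T ∈ ℝ^d be unit vectors. Define z_t = A_⊗^{−1/2} (e_{i_t} ⊗ x_t) and M_T = I_{dn} + Σ_{t=1}^T z_t z_t^T. Then trace(M_T) = dn + 2T/(n+1), and consequently ln det M_T ≤ dn · ln(1 + 2T/(dn(n+1))). -/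
open Matrix Kronecker

theorem Matrix.PosDef.log_det_le {m : Type*} [Fintype m] [DecidableEq m] [Nonempty m]
    {M : Matrix m m ℝ} (hM : M.PosDef) :
    Real.log M.det ≤ Fintype.card m * Real.log (M.trace / Fintype.card m) := by
  have hm : (0 : ℝ) < Fintype.card m := by exact_mod_cast Fintype.card_pos
  set c : ℝ := M.trace / Fintype.card m with hc
  have htrace : 0 < M.trace := hM.trace_pos
  have hc0 : 0 < c := div_pos htrace hm
  have hdet : M.det = ∏ j, hM.isHermitian.eigenvalues j := by
    simpa using hM.isHermitian.det_eq_prod_eigenvalues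
  have hsum : M.trace = ∑ j, hM.isHermitian.eigenvalues j := by
    simpa using hM.isHermitian.trace_eq_sum_eigenvalues
  have hle : ∀ j, Real.log (hM.isHermitian.eigenvalues j) ≤
      hM.isHermitian.eigenvalues j / c + (Real.log c - 1) := fun j => by
    have hj := hM.eigenvalues_pos j
    have h := Real.log_le_sub_one_of_pos (div_pos hj hc0)
    rw [Real.log_div hj.ne' hc0.ne'] at h
    linarith
  rw [hdet, Real.log_prod fun j _ => (hM.eigenvalues_pos j).ne']
  refine (Finset.sum_le_sum fun j _ => hle j).trans_eq ?_
  have hdiv : M.trace / c = Fintype.card m := by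
    rw [hc]
    field_simp
  rw [Finset.sum_add_distrib, ← Finset.sum_div, ← hsum, hdiv]
  simp

/-- The regularised Laplacian of the complete graph inverts explicitly. -/
theorem one_add_completeGraph_laplacian_mul (n : ℕ) :
    ((1 : Matrix (Fin n) (Fin n) ℝ) +
        ((n : ℝ) • (1 : Matrix (Fin n) (Fin n) ℝ) - Matrix.of (fun _ _ => (1 : ℝ)))) *
      (((n : ℝ) + 1)⁻¹ • (1 + Matrix.of (fun _ _ => (1 : ℝ)))) = 1 := by
  have hn : (n : ℝ) + 1 ≠ 0 := by positivity
  have hJ : (Matrix.of (fun _ _ => (1 : ℝ)) : Matrix (Fin n) (Fin n) ℝ) *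
      Matrix.of (fun _ _ => (1 : ℝ)) = (n : ℝ) • Matrix.of (fun _ _ => (1 : ℝ)) := by
    ext a b
    simp [Matrix.mul_apply]
  rw [Matrix.mul_smul, inv_smul_eq_iff₀ hn]
  simp only [add_mul, sub_mul, mul_add, one_mul, mul_one, smul_mul_assoc, hJ]
  module

theorem single_kronecker_quadratic_form {m k : Type*} [Fintype m] [Fintype k] [DecidableEq m]
    [DecidableEq k] (B : Matrix m m ℝ) (a : m) (v : EuclideanSpace ℝ k) :
    (fun p : m × k => (if p.1 = a then (1 : ℝ) else 0) * v p.2) ⬝ᵥ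
      (B ⊗ₖ (1 : Matrix k k ℝ)) *ᵥ (fun p : m × k => (if p.1 = a then (1 : ℝ) else 0) * v p.2) =
      B a a * ‖v‖ ^ 2 := by
  simp only [dotProduct, mulVec, Fintype.sum_prod_type, kroneckerMap_apply, one_apply,
    EuclideanSpace.real_norm_sq_eq, Finset.mul_sum]
  simp
  exact Finset.sum_congr rfl fun j _ => by ring

theorem dotProduct_self_inv_sqrt {m : Type*} [Fintype m] [DecidableEq m] {S B : Matrix m m ℝ}
    (hS : S.PosDef) (hB : S * S * B = 1) (v : m → ℝ) :
    (S⁻¹ *ᵥ v) ⬝ᵥ (S⁻¹ *ᵥ v) = v ⬝ᵥ B *ᵥ v := by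
  have hSt : (S⁻¹)ᵀ = S⁻¹ := by
    simpa [conjTranspose_eq_transpose_of_trivial] using hS.inv.isHermitian.eq
  have hinv : S⁻¹ * S⁻¹ = B := by
    rw [← Matrix.mul_inv_rev]
    exact Matrix.inv_eq_right_inv hB
  nth_rewrite 1 [← hSt]
  rw [mulVec_transpose, ← dotProduct_mulVec, mulVec_mulVec, hinv]

/-- In the complete-graph case, with `A_⊗ = (I + L) ⊗ I_d`, `S` its symmetric positive
definite square root (so `S⁻¹ = A_⊗^{-1/2}`), unit-norm contexts, and
`M_T = I + Σ_t z_t z_tᵀ` for `z_t = A_⊗^{-1/2}(e_{i_t} ⊗ x_t)`, one has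
`trace M_T = dn + 2T/(n+1)` and `ln det M_T ≤ dn · ln (1 + 2T/(dn(n+1)))`. -/
theorem trace_logdet_complete_graph (d n T : ℕ) (hd : 1 ≤ d) (hn : 1 ≤ n) (hT : 1 ≤ T)
    (i : Fin T → Fin n) (x : Fin T → EuclideanSpace ℝ (Fin d))
    (hx : ∀ t : Fin T, ‖x t‖ = 1)
    (S : Matrix (Fin n × Fin d) (Fin n × Fin d) ℝ) (hS : S.PosDef)
    (hSsq : S * S =
      ((1 : Matrix (Fin n) (Fin n) ℝ) +
          ((n : ℝ) • (1 : Matrix (Fin n) (Fin n) ℝ) - Matrix.of (fun _ _ => (1 : ℝ)))) ⊗ₖ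
        (1 : Matrix (Fin d) (Fin d) ℝ)) :
    let φ : Fin T → (Fin n × Fin d → ℝ) :=
      fun t p => (if p.1 = i t then (1 : ℝ) else 0) * x t p.2
    let z : Fin T → (Fin n × Fin d → ℝ) := fun t => S⁻¹ *ᵥ φ t
    let M : Matrix (Fin n × Fin d) (Fin n × Fin d) ℝ :=
      1 + ∑ t : Fin T, vecMulVec (z t) (z t)
    M.trace = d * n + 2 * T / ((n : ℝ) + 1) ∧
      Real.log M.det ≤
        (d * n : ℝ) * Real.log (1 + 2 * (T : ℝ) / ((d * n : ℝ) * ((n : ℝ) + 1))) := by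
  intro φ z M
  have : Nonempty (Fin n × Fin d) := ⟨(⟨0, hn⟩, ⟨0, hd⟩)⟩
  have hn0 : (0 : ℝ) < n := by exact_mod_cast hn
  have hd0 : (0 : ℝ) < d := by exact_mod_cast hd
  have hinv : S * S * ((((n : ℝ) + 1)⁻¹ • ((1 : Matrix (Fin n) (Fin n) ℝ) +
      Matrix.of (fun _ _ => (1 : ℝ)))) ⊗ₖ (1 : Matrix (Fin d) (Fin d) ℝ)) = 1 := by
    rw [hSsq, ← mul_kronecker_mul, one_add_completeGraph_laplacian_mul, one_mul, one_kronecker_one]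
  have hz : ∀ t, z t ⬝ᵥ z t = 2 / ((n : ℝ) + 1) := fun t => by
    rw [dotProduct_self_inv_sqrt hS hinv, single_kronecker_quadratic_form, hx t]
    simp
    ring
  have htrace : M.trace = d * n + 2 * T / ((n : ℝ) + 1) := by
    simp only [M, trace_add, trace_sum, trace_vecMulVec, hz, trace_one]
    simp
    ring
  have hM : M.PosDef := PosDef.one.add_posSemidef <| posSemidef_sum _ fun t _ => by
    simpa using posSemidef_vecMulVec_self_star (z t)
  refine ⟨htrace, ?_⟩
  have hcard : (Fintype.card (Fin n × Fin d) : ℝ) = d * n := by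
    simp [mul_comm]
  have hlog := hM.log_det_le
  rw [hcard, htrace] at hlog
  convert hlog using 3
  field_simp
end

section
/- (Deterministic core of Theorem 1.) Let G = (V,E) be a finite simple undirected graph on n vertices with Laplacian L, let d ≥ 1, set A_⊗ = (I_n + L) ⊗ I_d, and let u_1,...,u_n ∈ ℝ^d with stacked vector U ∈ ℝ^{dn} and Ũ = A_⊗^{1/2} U. Define L(u_1,...,u_n) = Σ_{i∈V} ‖u_i‖² + Σ_{(i,j)∈E} ‖u_i − u_j‖². Fix T ≥ 1, σ > 0, B > 0, and 0 < δ ≤ 1. For each t = 1,...,T let i_t ∈ {1,...,n} and let x_{t,1},...,x_{t,c_t} ∈ ℝ^d with ‖x_{t,k}‖ ≤ B for all k, and set φ̃_{t,k} = A_⊗^{−1/2}(e_{i_t} ⊗ x_{t,k}). Let rewards a_1,...,a_T ∈ ℝ be arbitrary and define recursively: M_0 = I_{dn}, b_0 = 0, w_{t−1} = M_{t−1}^{−1} b_{t−1}, cb_t(φ) = √(φ^T M_{t−1}^{−1} φ) · (σ√(ln(det(M_t)/δ)) + ‖Ũ‖), k_t = an index maximizing w_{t−1}^T φ̃_{t,k}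 + cb_t(φ̃_{t,k}) over k ∈ {1,...,c_t}, M_t = M_{t−1} + φ̃_{t,k_t} φ̃_{t,k_t}^T, b_t = b_{t−1} + a_t φ̃_{t,k_t}. Assume the confidence event holds: for every t ∈ {1,...,T} and every k ∈ {1,...,c_t}, |Ũ^T φ̃_{t,k} − w_{t−1}^T φ̃_{t,k}| ≤ cb_t(φ̃_{t,k}). Then the cumulative regret satisfies Σ_{t=1}^T ( max_{k=1,...,c_t} u_{i_t}^T x_{t,k} − u_{i_t}^T x_{t,k_t} ) ≤ 2 √( T · ( 2σ² ln(det(M_T)/δ) + 2 L(u_1,...,u_n) ) · (1 + B²) · ln det M_T ). -/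
open Matrix Kronecker RealInnerProductSpace

section LinearAlgebra

variable {m : Type*} [Fintype m] [DecidableEq m]

/-- The matrix determinant lemma for a symmetric rank-one update. -/
lemma Matrix.det_add_vecMulVec_self {M : Matrix m m ℝ} (hM : IsUnit M.det) (v : m → ℝ) :
    (M + vecMulVec v v).det = M.det * (1 + v ⬝ᵥ (M⁻¹ *ᵥ v)) := by
  rw [vecMulVec_eq Unit, det_add_replicateCol_mul_replicateRow hM, Matrix.mul_assoc,
    ← replicateCol_mulVec, det_unique (n := Unit), add_apply, one_apply_eq,
    replicateRow_mul_replicateCol_apply]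

/-- If `M` dominates the identity in the Loewner order, then `M⁻¹` is dominated by it. -/
lemma Matrix.PosSemidef.dotProduct_inv_mulVec_le_s15 {M : Matrix m m ℝ} (hM : (M - 1).PosSemidef)
    (v : m → ℝ) : v ⬝ᵥ (M⁻¹ *ᵥ v) ≤ v ⬝ᵥ v := by
  have hPD : M.PosDef := by simpa using PosDef.one.add_posSemidef hM
  set y := M⁻¹ *ᵥ v
  have hv : v = y + (M - 1) *ᵥ y := by
    rw [sub_mulVec, one_mulVec, add_sub_cancel, mulVec_mulVec,
      mul_nonsing_inv _ ((isUnit_iff_isUnit_det _).1 hPD.isUnit), one_mulVec]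
  set z := (M - 1) *ᵥ y with hz
  have hyz : 0 ≤ y ⬝ᵥ z := by simpa using hM.dotProduct_mulVec_nonneg y
  have hzz : 0 ≤ z ⬝ᵥ z := by simpa using dotProduct_star_self_nonneg z
  rw [hv, dotProduct_comm, dotProduct_add, dotProduct_add, add_dotProduct, add_dotProduct,
    dotProduct_comm z y]
  linarith

/-- If `S` is a symmetric square root of a matrix dominating the identity, then `S⁻¹`
is a contraction for the Euclidean norm. -/
lemma Matrix.IsHermitian.inv_mulVec_dotProduct_self_le {S : Matrix m m ℝ} (hS : S.IsHermitian)
    (hdom : (S * S - 1).PosSemidef) (z : m → ℝ) :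
    (S⁻¹ *ᵥ z) ⬝ᵥ (S⁻¹ *ᵥ z) ≤ z ⬝ᵥ z := by
  have hT : (S⁻¹)ᵀ = S⁻¹ := by simpa [IsHermitian] using hS.inv
  have h := hdom.dotProduct_inv_mulVec_le_s15 z
  rwa [Matrix.mul_inv_rev, ← mulVec_mulVec, dotProduct_mulVec, ← mulVec_transpose, hT] at h

/-- A symmetric invertible matrix and its inverse cancel across the dot product. -/
lemma Matrix.IsHermitian.mulVec_dotProduct_inv_mulVec {S : Matrix m m ℝ} (hS : S.IsHermitian)
    (hunit : IsUnit S.det) (y z : m → ℝ) : (S *ᵥ y) ⬝ᵥ (S⁻¹ *ᵥ z) = y ⬝ᵥ z := by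
  have hT : Sᵀ = S := by simpa [IsHermitian] using hS
  rw [← vecMul_transpose, hT, ← dotProduct_mulVec, mulVec_mulVec, mul_nonsing_inv _ hunit,
    one_mulVec]

end LinearAlgebra

section Graph

open Finset

variable {V : Type*} [Fintype V] [DecidableEq V] (G : SimpleGraph V) [DecidableRel G.Adj]

/-- Summing over ordered pairs of adjacent vertices counts every edge twice. -/
lemma SimpleGraph.sum_adj_eq_two_mul_sum_edgeFinset (f : Sym2 V → ℝ) :
    ∑ i, ∑ j, (if G.Adj i j then f s(i, j) else 0) = 2 * ∑ e ∈ G.edgeFinset, f e := by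
  have hdart : ∑ d : G.Dart, f d.edge = ∑ e ∈ G.edgeFinset, 2 * f e := by
    rw [← sum_fiberwise_of_maps_to (g := Dart.edge) (t := G.edgeFinset)
      fun d _ => mem_edgeFinset.2 d.edge_mem]
    refine sum_congr rfl fun e he => ?_
    rw [sum_congr rfl fun d hd => by rw [(mem_filter.1 hd).2], sum_const,
      G.dart_edge_fiber_card e (mem_edgeFinset.1 he), nsmul_eq_mul, Nat.cast_ofNat]
  rw [mul_sum, ← hdart, ← sum_product', univ_product_univ, ← sum_filter]
  exact sum_bij' (fun p hp => ⟨p, (mem_filter.1 hp).2⟩) (fun d _ => d.toProd)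
    (by simp) (by simp) (by simp) (by simp) (by simp [Dart.edge])

lemma SimpleGraph.dotProduct_lapMatrix_mulVec (y : V → ℝ) :
    y ⬝ᵥ (G.lapMatrix ℝ *ᵥ y) = (∑ i, ∑ j, if G.Adj i j then (y i - y j) ^ 2 else 0) / 2 := by
  rw [← lapMatrix_toLinearMap₂', toLinearMap₂'_apply']

/-- The quadratic form of `(1 + L) ⊗ 1` is the Laplacian-regularized squared norm. -/
lemma SimpleGraph.dotProduct_one_add_lapMatrix_kronecker_mulVec {ι : Type*} [Fintype ι]
    [DecidableEq ι] (u : V → EuclideanSpace ℝ ι) (f : Sym2 V → ℝ)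
    (hf : ∀ i j, f s(i, j) = ‖u i - u j‖ ^ 2) :
    (fun p : V × ι => u p.1 p.2) ⬝ᵥ
        (((1 + G.lapMatrix ℝ) ⊗ₖ (1 : Matrix ι ι ℝ)) *ᵥ fun p : V × ι => u p.1 p.2) =
      ∑ j, ‖u j‖ ^ 2 + ∑ e ∈ G.edgeFinset, f e := by
  have hcoord (A : Matrix V V ℝ) : (fun p : V × ι => u p.1 p.2) ⬝ᵥ
      ((A ⊗ₖ (1 : Matrix ι ι ℝ)) *ᵥ fun p : V × ι => u p.1 p.2) =
      ∑ l, (fun j => u j l) ⬝ᵥ (A *ᵥ fun j => u j l) := by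
    simp only [dotProduct, mulVec, Fintype.sum_prod_type, kroneckerMap_apply, one_apply, mul_ite,
      mul_one, mul_zero, ite_mul, zero_mul, sum_ite_eq, mem_univ, if_true]
    exact sum_comm
  have hedge : ∑ e ∈ G.edgeFinset, f e =
      (∑ i, ∑ j, if G.Adj i j then ‖u i - u j‖ ^ 2 else 0) / 2 := by
    have h := G.sum_adj_eq_two_mul_sum_edgeFinset f
    simp only [hf] at h
    linarith
  simp only [hcoord, add_mulVec, one_mulVec, dotProduct_add, sum_add_distrib,
    G.dotProduct_lapMatrix_mulVec, hedge]
  congr 1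
  · simp only [EuclideanSpace.real_norm_sq_eq, dotProduct, ← sq]
    exact sum_comm
  · rw [← sum_div, sum_comm]
    congr 1
    refine sum_congr rfl fun i _ => ?_
    rw [sum_comm]
    refine sum_congr rfl fun j _ => ?_
    split_ifs <;> simp [EuclideanSpace.real_norm_sq_eq]

end Graph

lemma Real.le_one_add_mul_log_one_add_s15 {q C : ℝ} (hq : 0 ≤ q) (hqC : q ≤ C) :
    q ≤ (1 + C) * Real.log (1 + q) := by
  have hpos : 0 < 1 + q := by linarith
  have hlog := Real.one_sub_inv_le_log_of_pos hpos
  have hq' : q = (1 + q) * (1 - (1 + q)⁻¹) := by field_simp; ring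
  calc q = (1 + q) * (1 - (1 + q)⁻¹) := hq'
    _ ≤ (1 + q) * Real.log (1 + q) := by gcongr
    _ ≤ (1 + C) * Real.log (1 + q) := by
      gcongr
      exact Real.log_nonneg (by linarith)

/-- Matrices built from the identity by symmetric rank-one updates dominate the identity. -/
lemma posSemidef_sub_one_of_rankOne_updates {m : Type*} [Fintype m] [DecidableEq m] {T : ℕ}
    {M : ℕ → Matrix m m ℝ} {φ : Fin T → m → ℝ} (hM0 : M 0 = 1)
    (hM : ∀ t : Fin T, M (t + 1) = M t + vecMulVec (φ t) (φ t)) :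
    ∀ s ≤ T, (M s - 1).PosSemidef := by
  intro s
  induction s with
  | zero => intro _; rw [hM0, sub_self]; exact .zero
  | succ s ih =>
    intro hs
    rw [hM ⟨s, hs⟩, add_sub_right_comm]
    exact (ih (by lia)).add (by simpa using posSemidef_vecMulVec_self_star (φ ⟨s, hs⟩))

/-- Determinants are nondecreasing along rank-one updates, and the elliptical potential
`∑ φₜᵀ M_{t-1}⁻¹ φₜ` is controlled by the logarithm of the final determinant. -/
lemma elliptical_potential_s15 {m : Type*} [Fintype m] [DecidableEq m] {T : ℕ}
    {M : ℕ → Matrix m m ℝ} {φ : Fin T → m → ℝ} {C : ℝ} (hM0 : M 0 = 1)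
    (hM : ∀ t : Fin T, M (t + 1) = M t + vecMulVec (φ t) (φ t))
    (hφ : ∀ t, φ t ⬝ᵥ φ t ≤ C) :
    (∀ s r, s ≤ r → r ≤ T → (M s).det ≤ (M r).det) ∧
      (∀ t : Fin T, 0 ≤ φ t ⬝ᵥ ((M t)⁻¹ *ᵥ φ t)) ∧
      ∑ t : Fin T, φ t ⬝ᵥ ((M t)⁻¹ *ᵥ φ t) ≤ (1 + C) * Real.log (M T).det := by
  have hdom := posSemidef_sub_one_of_rankOne_updates hM0 hM
  have hPD (s : ℕ) (hs : s ≤ T) : (M s).PosDef := by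
    simpa using PosDef.one.add_posSemidef (hdom s hs)
  have hq (t : Fin T) : 0 ≤ φ t ⬝ᵥ ((M t)⁻¹ *ᵥ φ t) := by
    simpa using (hPD t t.2.le).inv.posSemidef.dotProduct_mulVec_nonneg (φ t)
  have hdet (t : Fin T) :
      (M (t + 1)).det = (M t).det * (1 + φ t ⬝ᵥ ((M t)⁻¹ *ᵥ φ t)) := by
    rw [hM t, det_add_vecMulVec_self (hPD t t.2.le).det_pos.ne'.isUnit]
  refine ⟨fun s r hsr => ?_, hq, ?_⟩
  · induction r, hsr using Nat.le_induction with
    | base => intro _; rfl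
    | succ r hsr ih =>
      intro hr
      refine (ih (by lia)).trans ?_
      rw [hdet ⟨r, hr⟩]
      exact le_mul_of_one_le_right (hPD r (by lia)).det_pos.le (by linarith [hq ⟨r, hr⟩])
  · have hstep (t : Fin T) : φ t ⬝ᵥ ((M t)⁻¹ *ᵥ φ t) ≤
        (1 + C) * (Real.log (M (t + 1)).det - Real.log (M t).det) := by
      rw [hdet t, Real.log_mul (hPD t t.2.le).det_pos.ne' (by linarith [hq t]),
        add_sub_cancel_left]
      exact Real.le_one_add_mul_log_one_add_s15 (hq t)
        (((hdom t t.2.le).dotProduct_inv_mulVec_le_s15 (φ t)).trans (hφ t))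
    refine (Finset.sum_le_sum fun t _ => hstep t).trans_eq ?_
    rw [← Finset.mul_sum,
      Fin.sum_univ_eq_sum_range (fun s => Real.log (M (s + 1)).det - Real.log (M s).det) T,
      Finset.sum_range_sub fun s => Real.log (M s).det]
    simp [hM0]

open Matrix Kronecker RealInnerProductSpace
/-- Deterministic core of Theorem 1 of the paper: under the assumption that the
confidence inequalities hold at every step, the cumulative regret of GOB.Lin on a
graph `G` with Laplacian `L`, `A_⊗ = (I + L) ⊗ I_d` (with symmetric positive definite
square root `S`), satisfies
`Σ_t (max_k u_{i_t}ᵀ x_{t,k} − u_{i_t}ᵀ x_{t,k_t}) ≤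
  2 √(T (2σ² ln(det M_T/δ) + 2 L(u_1,…,u_n)) (1 + B²) ln det M_T)`. -/
theorem goblin_regret_deterministic_core (n d T : ℕ) (hn : 1 ≤ n) (hd : 1 ≤ d) (hT : 1 ≤ T)
    (G : SimpleGraph (Fin n)) [DecidableRel G.Adj]
    (u : Fin n → EuclideanSpace ℝ (Fin d))
    (S : Matrix (Fin n × Fin d) (Fin n × Fin d) ℝ) (hS : S.PosDef)
    (hSsq : S * S = ((1 : Matrix (Fin n) (Fin n) ℝ) + G.lapMatrix ℝ) ⊗ₖ
      (1 : Matrix (Fin d) (Fin d) ℝ))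
    (σ B δ : ℝ) (hσ : 0 < σ) (hB : 0 < B) (hδ0 : 0 < δ) (hδ1 : δ ≤ 1)
    (c : Fin T → ℕ) (hc : ∀ t : Fin T, 1 ≤ c t)
    (i : Fin T → Fin n)
    (x : (t : Fin T) → Fin (c t) → EuclideanSpace ℝ (Fin d))
    (hx : ∀ (t : Fin T) (k' : Fin (c t)), ‖x t k'‖ ≤ B)
    (a : Fin T → ℝ)
    (M : ℕ → Matrix (Fin n × Fin d) (Fin n × Fin d) ℝ)
    (bvec : ℕ → (Fin n × Fin d → ℝ))
    (k : (t : Fin T) → Fin (c t))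
    (hM0 : M 0 = 1) (hb0 : bvec 0 = 0) :
    -- the Laplacian regularizer L(u_1,…,u_n)
    let Lquad : ℝ := (∑ j : Fin n, ‖u j‖ ^ 2) +
      ∑ e ∈ G.edgeFinset,
        Sym2.lift ⟨fun i' j' => ‖u i' - u j'‖ ^ 2, fun i' j' => by simp [norm_sub_rev]⟩ e
    -- the stacked vector U and Ũ = A_⊗^{1/2} U
    let U : Fin n × Fin d → ℝ := fun p => u p.1 p.2
    let Ut : Fin n × Fin d → ℝ := S *ᵥ U
    -- the modified context vectors φ̃_{t,k} = A_⊗^{-1/2} (e_{i_t} ⊗ x_{t,k})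
    let φt : (t : Fin T) → Fin (c t) → (Fin n × Fin d → ℝ) :=
      fun t k' => S⁻¹ *ᵥ (fun p => (if p.1 = i t then (1 : ℝ) else 0) * x t k' p.2)
    -- the least-squares weights w_{t-1} = M_{t-1}⁻¹ b_{t-1}
    let w : ℕ → (Fin n × Fin d → ℝ) := fun t => (M t)⁻¹ *ᵥ bvec t
    -- the confidence width cb_t(φ) = √(φᵀ M_{t-1}⁻¹ φ) (σ √(ln(det M_t/δ)) + ‖Ũ‖)
    let cb : Fin T → (Fin n × Fin d → ℝ) → ℝ := fun t v =>
      Real.sqrt (v ⬝ᵥ ((M (t : ℕ))⁻¹ *ᵥ v)) *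
        (σ * Real.sqrt (Real.log ((M ((t : ℕ) + 1)).det / δ)) + Real.sqrt (Ut ⬝ᵥ Ut))
    -- k_t maximizes the upper-confidence index
    (∀ (t : Fin T) (k' : Fin (c t)),
        w (t : ℕ) ⬝ᵥ φt t k' + cb t (φt t k') ≤
          w (t : ℕ) ⬝ᵥ φt t (k t) + cb t (φt t (k t))) →
    -- the rank-one update of M and the additive update of b
    (∀ t : Fin T, M ((t : ℕ) + 1) = M (t : ℕ) + vecMulVec (φt t (k t)) (φt t (k t))) →
    (∀ t : Fin T, bvec ((t : ℕ) + 1) = bvec (t : ℕ) + a t • φt t (k t)) →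
    -- the confidence event
    (∀ (t : Fin T) (k' : Fin (c t)),
        |Ut ⬝ᵥ φt t k' - w (t : ℕ) ⬝ᵥ φt t k'| ≤ cb t (φt t k')) →
    -- the regret bound
    ∑ t : Fin T,
        ((Finset.univ.sup' ⟨⟨0, hc t⟩, Finset.mem_univ _⟩ fun k' => (⟪u (i t), x t k'⟫ : ℝ)) -
          ⟪u (i t), x t (k t)⟫) ≤
      2 * Real.sqrt ((T : ℝ) * (2 * σ ^ 2 * Real.log ((M T).det / δ) + 2 * Lquad) *
        (1 + B ^ 2) * Real.log (M T).det) := by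
  intro Lquad U Ut φt w cb hk hM hb hconf
  have hunit : IsUnit S.det := hS.det_pos.ne'.isUnit
  have hherm : S.IsHermitian := hS.isHermitian
  have hdom : (S * S - 1).PosSemidef := by
    rw [hSsq, add_kronecker, one_kronecker_one, add_sub_cancel_left]
    exact (SimpleGraph.posSemidef_lapMatrix ℝ G).kronecker .one
  have hnorm : Ut ⬝ᵥ Ut = Lquad := by
    have hT : Sᵀ = S := by simpa [IsHermitian] using hherm
    have hUtU : Ut ⬝ᵥ Ut = U ⬝ᵥ ((S * S) *ᵥ U) := by
      rw [← mulVec_mulVec, dotProduct_mulVec U, ← mulVec_transpose, hT]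
    rw [hUtU, hSsq]
    exact G.dotProduct_one_add_lapMatrix_kronecker_mulVec u _ fun _ _ => rfl
  have hinner (t : Fin T) (k' : Fin (c t)) : Ut ⬝ᵥ φt t k' = ⟪u (i t), x t k'⟫ := by
    rw [show Ut ⬝ᵥ φt t k' = U ⬝ᵥ _ from hherm.mulVec_dotProduct_inv_mulVec hunit _ _]
    simp [U, dotProduct, Fintype.sum_prod_type, PiLp.inner_apply, mul_comm]
  have hφ (t : Fin T) : φt t (k t) ⬝ᵥ φt t (k t) ≤ B ^ 2 := by
    refine (hherm.inv_mulVec_dotProduct_self_le hdom _).trans ?_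
    have hz : (fun p : Fin n × Fin d => (if p.1 = i t then (1 : ℝ) else 0) * x t (k t) p.2) ⬝ᵥ
        (fun p => (if p.1 = i t then (1 : ℝ) else 0) * x t (k t) p.2) = ‖x t (k t)‖ ^ 2 := by
      rw [EuclideanSpace.real_norm_sq_eq]
      simp [dotProduct, Fintype.sum_prod_type, sq]
    rw [hz]
    exact pow_le_pow_left₀ (norm_nonneg _) (hx t (k t)) 2
  obtain ⟨hmono, hq, hsum⟩ := elliptical_potential_s15 hM0 hM hφ
  set q : Fin T → ℝ := fun t => φt t (k t) ⬝ᵥ ((M t)⁻¹ *ᵥ φt t (k t))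
  set R : ℝ := σ * √(Real.log ((M T).det / δ)) + √(Ut ⬝ᵥ Ut)
  have hdet_one (s : ℕ) (hs : s ≤ T) : 1 ≤ (M s).det := by
    simpa [hM0] using hmono 0 s (Nat.zero_le s) hs
  have hlogδ : 0 ≤ Real.log ((M T).det / δ) :=
    Real.log_nonneg ((one_le_div hδ0).2 (hδ1.trans (hdet_one T le_rfl)))
  have hUt : 0 ≤ Ut ⬝ᵥ Ut := by simpa using dotProduct_star_self_nonneg Ut
  have hregret (t : Fin T) :
      ((Finset.univ.sup' ⟨⟨0, hc t⟩, Finset.mem_univ _⟩ fun k' => (⟪u (i t), x t k'⟫ : ℝ)) -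
        ⟪u (i t), x t (k t)⟫) ≤ 2 * (√(q t) * R) := by
    have hcb : cb t (φt t (k t)) ≤ √(q t) * R := by
      have hpos := hdet_one (t + 1) t.2
      refine mul_le_mul_of_nonneg_left ?_ (Real.sqrt_nonneg _)
      simp only [R]
      gcongr
      exact hmono (t + 1) T t.2 le_rfl
    refine sub_le_iff_le_add.2 (Finset.sup'_le _ _ fun k' _ => ?_)
    rw [← hinner, ← hinner]
    linarith [(abs_le.1 (hconf t k')).2, (abs_le.1 (hconf t (k t))).1, hk t k']
  have hR2 : R ^ 2 ≤ 2 * σ ^ 2 * Real.log ((M T).det / δ) + 2 * Lquad := by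
    refine (add_sq_le (a := σ * √(Real.log ((M T).det / δ))) (b := √(Ut ⬝ᵥ Ut))).trans_eq ?_
    rw [mul_pow, Real.sq_sqrt hlogδ, Real.sq_sqrt hUt, hnorm]
    ring
  have hcauchy : (∑ t, √(q t)) ^ 2 ≤ T * ∑ t, q t := by
    have h := sq_sum_le_card_mul_sum_sq (s := Finset.univ) (f := fun t => √(q t))
    simpa [fun t => Real.sq_sqrt (show 0 ≤ q t from hq t)] using h
  refine (Finset.sum_le_sum fun t _ => hregret t).trans ?_
  rw [← Finset.mul_sum, ← Finset.sum_mul]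
  refine mul_le_mul_of_nonneg_left (Real.le_sqrt_of_sq_le ?_) zero_le_two
  calc ((∑ t, √(q t)) * R) ^ 2 = (∑ t, √(q t)) ^ 2 * R ^ 2 := mul_pow _ _ _
    _ ≤ (T * ((1 + B ^ 2) * Real.log (M T).det)) *
        (2 * σ ^ 2 * Real.log ((M T).det / δ) + 2 * Lquad) := by
      have hTq := mul_le_mul_of_nonneg_left hsum (Nat.cast_nonneg (α := ℝ) T)
      exact mul_le_mul (hcauchy.trans hTq) hR2 (sq_nonneg R)
        ((sq_nonneg _).trans (hcauchy.trans hTq))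
    _ = _ := by ring
end

section
/- Let d, n, T ≥ 1, let z_1,...,z_T ∈ ℝ^{dn} with ‖z_t‖ ≤ B for all t, let σ > 0, 0 < δ ≤ 1, C ≥ 0, and define M_0 = I_{dn}, M_t = M_{t−1} + z_t z_t^T. Suppose r_1,...,r_T are reals satisfying 0 ≤ r_t ≤ 2 √(z_t^T M_{t−1}^{−1} z_t) · (σ√(ln(det(M_t)/δ)) + C) for every t. Then Σ_{t=1}^T r_t ≤ 2 √( T · (2σ² ln(det(M_T)/δ) + 2C²) · (1 + B²) · ln det M_T ). -/
open Matrix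

namespace Matrix

/-- The matrix determinant lemma for a rank-one update, without replicated rows and columns. -/
lemma det_add_vecMulVec_s16 {m R : Type*} [Fintype m] [DecidableEq m] [CommRing R]
    {A : Matrix m m R} (hA : IsUnit A.det) (u v : m → R) :
    (A + vecMulVec u v).det = A.det * (1 + v ⬝ᵥ (A⁻¹ *ᵥ u)) := by
  rw [vecMulVec_eq Unit, det_add_replicateCol_mul_replicateRow hA, Matrix.mul_assoc,
    ← replicateCol_mulVec, det_unique (n := Unit), add_apply, one_apply_eq,
    replicateRow_mul_replicateCol_apply]

/-- If `A ≥ 1` in the Loewner order then `A⁻¹ ≤ 1` as a quadratic form. -/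
lemma dotProduct_inv_mulVec_le_dotProduct_self {m : Type*} [Fintype m] [DecidableEq m]
    {A : Matrix m m ℝ} (hA : IsUnit A.det) (h : (A - 1).PosSemidef) (v : m → ℝ) :
    v ⬝ᵥ (A⁻¹ *ᵥ v) ≤ v ⬝ᵥ v := by
  obtain ⟨w, hw⟩ : ∃ w, w = A⁻¹ *ᵥ v := ⟨_, rfl⟩
  have hv : v = w + (A - 1) *ᵥ w := by
    rw [sub_mulVec, one_mulVec, add_sub_cancel, hw, mulVec_mulVec, mul_nonsing_inv _ hA,
      one_mulVec]
  have h₁ : 0 ≤ w ⬝ᵥ ((A - 1) *ᵥ w) := by simpa using h.dotProduct_mulVec_nonneg w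
  have h₂ : 0 ≤ ((A - 1) *ᵥ w) ⬝ᵥ ((A - 1) *ᵥ w) := by
    simpa using dotProduct_star_self_nonneg ((A - 1) *ᵥ w)
  generalize (A - 1) *ᵥ w = y at hv h₁ h₂
  rw [← hw, hv]
  simp only [add_dotProduct, dotProduct_add]
  linarith

/-- A matrix that dominates the identity in the Loewner order is positive definite. -/
lemma PosSemidef.posDef_of_sub_one {m : Type*} [Finite m] [DecidableEq m] {A : Matrix m m ℝ}
    (h : (A - 1).PosSemidef) : A.PosDef := by
  simpa using PosDef.one.add_posSemidef h

end Matrix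

/-- The scalar inequality behind the elliptical potential bound. -/
lemma Real.le_one_add_mul_log_one_add_s16 {x b : ℝ} (hx : 0 ≤ x) (hxb : x ≤ b) :
    x ≤ (1 + b) * Real.log (1 + x) := by
  have h := Real.one_sub_inv_le_log_of_pos (show 0 < 1 + x by linarith)
  have hlog : 0 ≤ Real.log (1 + x) := Real.log_nonneg (by linarith)
  calc x = (1 + x) * (1 - (1 + x)⁻¹) := by field_simp; ring
    _ ≤ (1 + x) * Real.log (1 + x) := by gcongr
    _ ≤ (1 + b) * Real.log (1 + x) := by gcongr

/-- The chain of inequalities in the proof of Theorem 1: if each per-step regret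
`r_t` is bounded by twice the confidence width
`√(z_tᵀ M_{t-1}⁻¹ z_t) (σ √(ln(det M_t / δ)) + C)`, then the cumulative regret is at
most `2 √(T (2σ² ln(det M_T / δ) + 2C²) (1 + B²) ln det M_T)`. -/
theorem regret_chain_bound (d n T : ℕ) (hd : 1 ≤ d) (hn : 1 ≤ n) (hT : 1 ≤ T)
    (B σ δ C : ℝ) (hσ : 0 < σ) (hδ0 : 0 < δ) (hδ1 : δ ≤ 1) (hC : 0 ≤ C)
    (z : Fin T → EuclideanSpace ℝ (Fin (d * n)))
    (hz : ∀ t : Fin T, ‖z t‖ ≤ B)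
    (M : ℕ → Matrix (Fin (d * n)) (Fin (d * n)) ℝ)
    (hM0 : M 0 = 1)
    (hM : ∀ t : Fin T, M ((t : ℕ) + 1) = M (t : ℕ) + vecMulVec (z t) (z t))
    (r : Fin T → ℝ)
    (hr0 : ∀ t : Fin T, 0 ≤ r t)
    (hr : ∀ t : Fin T,
      r t ≤ 2 * Real.sqrt (z t ⬝ᵥ ((M (t : ℕ))⁻¹ *ᵥ z t)) *
        (σ * Real.sqrt (Real.log ((M ((t : ℕ) + 1)).det / δ)) + C)) :
    ∑ t : Fin T, r t ≤
      2 * Real.sqrt (T * (2 * σ ^ 2 * Real.log ((M T).det / δ) + 2 * C ^ 2) *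
        (1 + B ^ 2) * Real.log (M T).det) := by
  have hM1 : ∀ k ≤ T, (M k - 1).PosSemidef := by
    intro k
    induction k with
    | zero => intro _; simpa [hM0] using Matrix.PosSemidef.zero
    | succ k ih =>
      intro hk
      rw [hM ⟨k, hk⟩, add_sub_right_comm]
      exact (ih (by omega)).add (by simpa using posSemidef_vecMulVec_self_star (z ⟨k, hk⟩).ofLp)
  have hdet : ∀ k ≤ T, 0 < (M k).det := fun k hk => (hM1 k hk).posDef_of_sub_one.det_pos
  set x : Fin T → ℝ := fun t => z t ⬝ᵥ ((M (t : ℕ))⁻¹ *ᵥ z t)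
  have hx0 : ∀ t, 0 ≤ x t := fun t => by
    simpa using (hM1 t t.2.le).posDef_of_sub_one.inv.posSemidef.dotProduct_mulVec_nonneg (z t).ofLp
  have hxB : ∀ t, x t ≤ B ^ 2 := fun t => by
    refine (dotProduct_inv_mulVec_le_dotProduct_self (hdet t t.2.le).ne'.isUnit
      (hM1 t t.2.le) _).trans ?_
    have hnorm : (z t).ofLp ⬝ᵥ (z t).ofLp = ‖z t‖ ^ 2 := by
      rw [EuclideanSpace.real_norm_sq_eq]
      simp [dotProduct, sq]
    rw [hnorm]
    exact pow_le_pow_left₀ (norm_nonneg _) (hz t) 2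
  have hstep : ∀ t : Fin T, (M ((t : ℕ) + 1)).det = (M t).det * (1 + x t) := fun t => by
    rw [hM t, det_add_vecMulVec_s16 (hdet t t.2.le).ne'.isUnit]
  have hmono : ∀ k ≤ T, ∀ j ≤ k, (M j).det ≤ (M k).det := by
    intro k
    induction k with
    | zero => intro _ j hj; rw [Nat.le_zero.mp hj]
    | succ k ih =>
      intro hk j hj
      rcases hj.eq_or_lt with rfl | hj
      · exact le_rfl
      · refine (ih (by omega) j (by omega)).trans ?_
        rw [hstep ⟨k, hk⟩]
        exact le_mul_of_one_le_right (hdet k (by omega)).le (by linarith [hx0 ⟨k, hk⟩])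
  have hsum : ∑ t, x t ≤ (1 + B ^ 2) * Real.log (M T).det := by
    have htel : ∑ t : Fin T, Real.log (1 + x t) = Real.log (M T).det := by
      calc ∑ t : Fin T, Real.log (1 + x t)
          = ∑ t : Fin T, (Real.log (M ((t : ℕ) + 1)).det - Real.log (M (t : ℕ)).det) := by
            refine Finset.sum_congr rfl fun t _ => ?_
            rw [hstep t, Real.log_mul (hdet t t.2.le).ne' (by linarith [hx0 t])]
            ring
        _ = Real.log (M T).det := by
            rw [Fin.sum_univ_eq_sum_range
              (fun k => Real.log (M (k + 1)).det - Real.log (M k).det), Finset.sum_range_sub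
              (fun k => Real.log (M k).det)]
            simp [hM0]
    rw [← htel, Finset.mul_sum]
    exact Finset.sum_le_sum fun t _ => Real.le_one_add_mul_log_one_add_s16 (hx0 t) (hxB t)
  set L := Real.log ((M T).det / δ)
  have hL0 : 0 ≤ L := by
    have hdet_one : 1 ≤ (M T).det := by simpa [hM0] using hmono T le_rfl 0 (Nat.zero_le T)
    exact Real.log_nonneg ((one_le_div hδ0).2 (hδ1.trans hdet_one))
  have hrsq : ∀ t, r t ^ 2 ≤ 4 * (2 * σ ^ 2 * L + 2 * C ^ 2) * x t := fun t => by
    have hle : Real.log ((M ((t : ℕ) + 1)).det / δ) ≤ L := by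
      have := hdet _ t.2
      exact Real.log_le_log (by positivity) (by gcongr; exact hmono T le_rfl _ t.2)
    have hr' : r t ≤ 2 * √(x t) * (σ * √L + C) := (hr t).trans (by gcongr)
    calc r t ^ 2 ≤ (2 * √(x t) * (σ * √L + C)) ^ 2 := pow_le_pow_left₀ (hr0 t) hr' 2
      _ = 4 * x t * (σ * √L + C) ^ 2 := by rw [mul_pow, mul_pow, Real.sq_sqrt (hx0 t)]; ring
      _ ≤ 4 * x t * (2 * ((σ * √L) ^ 2 + C ^ 2)) := by
          have := hx0 t
          gcongr
          exact add_sq_le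
      _ = 4 * (2 * σ ^ 2 * L + 2 * C ^ 2) * x t := by rw [mul_pow, Real.sq_sqrt hL0]; ring
  have hcs : (∑ t, r t) ^ 2 ≤ 4 * (T * (2 * σ ^ 2 * L + 2 * C ^ 2) *
      (1 + B ^ 2) * Real.log (M T).det) := by
    calc (∑ t, r t) ^ 2 ≤ T * ∑ t, r t ^ 2 := by
          simpa using sq_sum_le_card_mul_sum_sq (s := Finset.univ) (f := r)
      _ ≤ T * ∑ t, 4 * (2 * σ ^ 2 * L + 2 * C ^ 2) * x t := by gcongr with t _; exact hrsq t
      _ = T * (4 * (2 * σ ^ 2 * L + 2 * C ^ 2) * ∑ t, x t) := by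
          rw [← Finset.mul_sum]
      _ ≤ T * (4 * (2 * σ ^ 2 * L + 2 * C ^ 2) * ((1 + B ^ 2) * Real.log (M T).det)) := by gcongr
      _ = _ := by ring
  have hhalf : (∑ t, r t) / 2 ≤ √(T * (2 * σ ^ 2 * L + 2 * C ^ 2) *
      (1 + B ^ 2) * Real.log (M T).det) :=
    Real.le_sqrt_of_sq_le (by linarith [div_pow (∑ t, r t) 2 2])
  linarith
end
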